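/- For every n ≥ 1: every funny assignment f of the separation formula Φₙ with sₙ(f) = m can be extended to a funny assignment f' with sₙ(f') = m that is defined on all existentially quantified variables of Φₙ; moreover, every total assignment of all variables of Φₙ that extends a funny assignment defined on all existentially quantified variables satisfies all clauses of φₙ. -/

import Mathlib

/-! Framework for quantified Boolean circuits (QBCs), QU-resolution,
relaxations, and the prover–delayer game, following Chen,
"Proof Complexity Modulo the Polynomial Hierarchy". -/

/-- Quantifiers. -/
inductive Quant where
  | all : Quant
  | ex : Quant
deriving DecidableEq

/-- A partial assignment of Boolean values to (numbered) propositional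
variables.  Via the correspondence `C ↔ assign(C)`, partial assignments also
represent clauses (the clause `clause(a)` is the unique clause with variable
set `dom a` falsified by `a`); we freely identify the two. -/
abbrev PA : Type := ℕ → Option Bool

/-- The everywhere-undefined partial assignment (= the empty clause). -/
def emptyPA : PA := fun _ => none

/-- `g` extends the partial assignment `f`. -/
def ExtendsPA (g f : PA) : Prop := ∀ v b, f v = some b → g v = some b

/-- A total assignment `g` extends a partial assignment `f`; when `f`
represents a clause, this says `g` falsifies that clause. -/
def TotalExtends (g : ℕ → Bool) (f : PA) : Prop := ∀ v b, f v = some b → g v = b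

/-- A partial assignment `r` satisfies a clause `C` (i.e. makes some literal
of `C` true). -/
def SatisfiedBy (r : PA) (C : PA) : Prop := ∃ v b, C v = some b ∧ r v = some (!b)

/-- A quantified Boolean circuit: a quantifier prefix (a list of
quantifier/variable pairs) together with a Boolean function on total
assignments, represented as a predicate. -/
structure QBC where
  pfx : List (Quant × ℕ)
  matrix : (ℕ → Bool) → Prop

/-- The variables of the prefix of a QBC. -/
def QBC.vars (Φ : QBC) : List ℕ := Φ.pfx.map Prod.snd

/-- Well-formedness of a QBC: the prefix has no repeated variables, and the
matrix depends only on the values of the prefix variables. -/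
def QBC.WellFormed (Φ : QBC) : Prop :=
  Φ.vars.Nodup ∧
  ∀ f g : ℕ → Bool, (∀ v ∈ Φ.vars, f v = g v) → (Φ.matrix f ↔ Φ.matrix g)

/-- Standard semantics of a quantifier prefix over a matrix, starting from a
base assignment. -/
def evalQ : List (Quant × ℕ) → ((ℕ → Bool) → Prop) → (ℕ → Bool) → Prop
  | [], φ, g => φ g
  | (Quant.ex, v) :: P, φ, g => ∃ b, evalQ P φ (Function.update g v b)
  | (Quant.all, v) :: P, φ, g => ∀ b, evalQ P φ (Function.update g v b)

/-- Truth of a QBC. -/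
def QBC.IsTrue (Φ : QBC) : Prop := ∀ g, evalQ Φ.pfx Φ.matrix g

/-- Falsity of a QBC. -/
def QBC.IsFalse (Φ : QBC) : Prop := ¬ Φ.IsTrue

/-- The existentially quantified variables of a prefix. -/
def existVars (P : List (Quant × ℕ)) : List ℕ :=
  (P.filter fun p => decide (p.1 = Quant.ex)).map Prod.snd

/-- The universally quantified variables of a prefix. -/
def univVars (P : List (Quant × ℕ)) : List ℕ :=
  (P.filter fun p => decide (p.1 = Quant.all)).map Prod.snd

/-- The relation `u ⪯ v` of a prefix: `vᵢ ⪯ vⱼ` iff `i ≤ j`, or `j < i` and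
`Qⱼ = Qⱼ₊₁ = ⋯ = Qᵢ`. -/
def preceq (P : List (Quant × ℕ)) (u v : ℕ) : Prop :=
  ∃ i j : ℕ, (P[i]?).map Prod.snd = some u ∧ (P[j]?).map Prod.snd = some v ∧
    (i ≤ j ∨ (j < i ∧ ∀ k, j ≤ k → k ≤ i → (P[k]?).map Prod.fst = (P[j]?).map Prod.fst))

/-- `u` strictly precedes `v` (`u ⪯ v` and not `v ⪯ u`). -/
def strictPrec (P : List (Quant × ℕ)) (u v : ℕ) : Prop :=
  preceq P u v ∧ ¬ preceq P v u

/-- dom(f) ⪯ y : every variable on which `f` is defined is `⪯ y`. -/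
def domPrec (P : List (Quant × ℕ)) (f : PA) (y : ℕ) : Prop :=
  ∀ u, f u ≠ none → preceq P u y

/-- An ∃-strategy: a family of response functions for the existential
variables, each depending only on the universal variables strictly
preceding it. -/
def IsExStrategy (Φ : QBC) (σ : ℕ → (ℕ → Bool) → Bool) : Prop :=
  ∀ x ∈ existVars Φ.pfx, ∀ τ τ' : ℕ → Bool,
    (∀ y ∈ univVars Φ.pfx, strictPrec Φ.pfx y x → τ y = τ' y) → σ x τ = σ x τ'

/-- The total assignment `⟨σ, τ⟩` induced by an ∃-strategy `σ` and an
assignment `τ` to the universal variables. -/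
def playE (Φ : QBC) (σ : ℕ → (ℕ → Bool) → Bool) (τ : ℕ → Bool) : ℕ → Bool :=
  fun v => if v ∈ existVars Φ.pfx then σ v τ else τ v

/-- `σ` is a winning ∃-strategy of the prefix of `Φ` for the matrix `M`. -/
def ModelOf (Φ : QBC) (M : (ℕ → Bool) → Prop) (σ : ℕ → (ℕ → Bool) → Bool) : Prop :=
  IsExStrategy Φ σ ∧ ∀ τ : ℕ → Bool, M (playE Φ σ τ)

/-- A model of `Φ` (a winning ∃-strategy). -/
def QBC.Model (Φ : QBC) (σ : ℕ → (ℕ → Bool) → Bool) : Prop :=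
  ModelOf Φ Φ.matrix σ

/-- `σ` is a model of `P : C`, where `P` is the prefix of `Φ` and `C` is a
clause (represented by its falsifying assignment). -/
def ModelOfClause (Φ : QBC) (σ : ℕ → (ℕ → Bool) → Bool) (C : PA) : Prop :=
  ModelOf Φ (fun g => ¬ TotalExtends g C) σ

/-- `C` is an axiom of `Φ`: a clause on the variables of `Φ` such that every
model of `Φ` is a model of `P : C`. -/
def IsAxiom (Φ : QBC) (C : PA) : Prop :=
  (∀ v, C v ≠ none → v ∈ Φ.vars) ∧ ∀ σ, Φ.Model σ → ModelOfClause Φ σ C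

/-- An axiom set of `Φ`. -/
def IsAxiomSet (Φ : QBC) (H : Set PA) : Prop := ∀ C ∈ H, IsAxiom Φ C

/-- A ∀-strategy: response functions for the universal variables, each
depending only on the existential variables strictly preceding it. -/
def IsUnivStrategy (Φ : QBC) (τ : ℕ → (ℕ → Bool) → Bool) : Prop :=
  ∀ y ∈ univVars Φ.pfx, ∀ σ σ' : ℕ → Bool,
    (∀ x ∈ existVars Φ.pfx, strictPrec Φ.pfx x y → σ x = σ' x) → τ y σ = τ y σ'

/-- The total assignment `⟨τ, σ⟩` induced by a ∀-strategy `τ` and an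
assignment `σ` to the existential variables. -/
def playU (Φ : QBC) (τ : ℕ → (ℕ → Bool) → Bool) (σ : ℕ → Bool) : ℕ → Bool :=
  fun v => if v ∈ univVars Φ.pfx then τ v σ else σ v

/-- A winning ∀-strategy: every play falsifies the matrix. -/
def WinningUnivStrategy (Φ : QBC) (τ : ℕ → (ℕ → Bool) → Bool) : Prop :=
  IsUnivStrategy Φ τ ∧ ∀ σ : ℕ → Bool, ¬ Φ.matrix (playU Φ τ σ)

/-- `C` is obtainable from `D` by ∀-elimination (relative to prefix `P`):
`C = D ∖ {L}` for a literal `L` on a universal variable `y` with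
`vars(C) ⪯ y`.  In assignment form: `D` is `C` additionally defined on `y`. -/
def ForallElim (P : List (Quant × ℕ)) (C D : PA) : Prop :=
  ∃ y b, y ∈ univVars P ∧ C y = none ∧ D = Function.update C y (some b) ∧
    ∀ u, C u ≠ none → preceq P u y

/-- `γ` is the resolvent of `α` and `β` on variable `v` (in falsifying
assignment form: `α` and `β` carry complementary literals on `v`, `γ` is
the union of the remainders, which must be a clause). -/
def IsResolvent (γ α β : PA) (v : ℕ) : Prop :=
  ∃ b, α v = some b ∧ β v = some (!b) ∧ γ v = none ∧
    (∀ u, u ≠ v → γ u = (α u).elim (β u) some) ∧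
    (∀ u, u ≠ v → ∀ b₁ b₂, α u = some b₁ → β u = some b₂ → b₁ = b₂)

/-- A step in a QU-resolution proof: an axiom, a ∀-elimination (annotated with
the index of its source), or a resolution step (annotated with the indices of
its two sources and the resolved variable). -/
inductive QUStep where
  | ax (C : PA)
  | elim (C : PA) (src : ℕ)
  | res (C : PA) (src₁ src₂ : ℕ) (v : ℕ)

/-- The clause of a proof step. -/
def QUStep.clause : QUStep → PA
  | .ax C => C
  | .elim C _ => C
  | .res C _ _ _ => C

/-- The clause at position `i` of a proof. -/
def stepClause? (L : List QUStep) (i : ℕ) : Option PA := (L[i]?).map QUStep.clause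

/-- Validity of the `i`-th step of a proof from axiom set `H`. -/
def validStep (P : List (Quant × ℕ)) (H : Set PA) (L : List QUStep) (i : ℕ) : Prop :=
  match L[i]? with
  | none => True
  | some (.ax C) => C ∈ H
  | some (.elim C j) => j < i ∧ ∃ D, stepClause? L j = some D ∧ ForallElim P C D
  | some (.res C j k v) => j < i ∧ k < i ∧
      ∃ α β, stepClause? L j = some α ∧ stepClause? L k = some β ∧ IsResolvent C α β v

/-- A QU-resolution proof of `Φ` from axiom set `H`. -/
def IsQUProof (Φ : QBC) (H : Set PA) (L : List QUStep) : Prop :=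
  ∀ i, validStep Φ.pfx H L i

/-- A QU-resolution falsity proof: a proof ending with the empty clause. -/
def IsFalsityProof (Φ : QBC) (H : Set PA) (L : List QUStep) : Prop :=
  IsQUProof Φ H L ∧ (L.getLast?).map QUStep.clause = some emptyPA

/-- The clause `C` appears in the proof `L`. -/
def AppearsIn (L : List QUStep) (C : PA) : Prop := ∃ i, stepClause? L i = some C

/-- The edge relation of the graph `G(π)`: an edge from each clause occurrence
to the clause occurrence(s) from which it is derived. -/
def edge (L : List QUStep) (i j : ℕ) : Prop :=
  match L[i]? with
  | some (.elim _ s) => j = s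
  | some (.res _ s t _) => j = s ∨ j = t
  | _ => False

/-- A sink (leaf) of `G(π)`: a vertex with no outgoing edges. -/
def isSink (L : List QUStep) (i : ℕ) : Prop := i < L.length ∧ ∀ j, ¬ edge L i j

/-- The proof is tree-like: `G(π)` is a tree (each vertex has at most one
incoming edge; acyclicity holds automatically since edges decrease indices). -/
def TreeLike (L : List QUStep) : Prop := ∀ j : ℕ, {i | edge L i j}.Subsingleton

-- The prefix `P[a]`: the variables of `dom a` are removed, and the
-- quantifier of every variable strictly preceding some variable of `dom a`
-- (equivalently, every `v` with `v ⪯ last(a)` and not `last(a) ⪯ v`) is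
-- changed to `∃`.
open Classical in
noncomputable def instPrefix (P : List (Quant × ℕ)) (a : PA) : List (Quant × ℕ) :=
  (P.filter fun p => (a p.2).isNone).map fun p =>
    (if ∃ u, a u ≠ none ∧ strictPrec P p.2 u then Quant.ex else p.1, p.2)

/-- Overriding a total assignment by a partial assignment. -/
def override (a : PA) (g : ℕ → Bool) : ℕ → Bool := fun v => (a v).getD (g v)

/-- The instantiated QBC `Φ[a]` = `P[a] : φ[a]`. -/
noncomputable def QBC.inst (Φ : QBC) (a : PA) : QBC :=
  ⟨instPrefix Φ.pfx a, fun g => Φ.matrix (override a g)⟩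

/-- `P'` is a relaxation of the prefix `P`: a permutation of `P` such that
`y ⪯ x` implies `y ⪯' x` for every universal `y` and existential `x`. -/
def IsRelaxationPfx (P P' : List (Quant × ℕ)) : Prop :=
  P.Perm P' ∧ ∀ y ∈ univVars P, ∀ x ∈ existVars P, preceq P y x → preceq P' y x

/-- `Φ'` is a relaxation of the QBC `Φ`. -/
def IsRelaxation (Φ Φ' : QBC) : Prop :=
  IsRelaxationPfx Φ.pfx Φ'.pfx ∧ Φ'.matrix = Φ.matrix

/-- Negation of a quantifier. -/
def Quant.neg : Quant → Quant
  | .all => .ex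
  | .ex => .all

/-- `isAltFrom q i qs`: the quantifier string `qs` consists of (at most) `i`
alternating possibly-empty blocks, starting with a block of `q`s. -/
def isAltFrom : Quant → ℕ → List Quant → Prop
  | _, 0, qs => qs = []
  | q, i + 1, qs => ∃ k rest, qs = List.replicate k q ++ rest ∧ isAltFrom q.neg i rest

/-- The prefix `P` is `Π_i`: its quantifier string lies in `∀*∃*∀*⋯` with `i`
alternating starred blocks beginning with `∀*`. -/
def isPiPrefix (i : ℕ) (P : List (Quant × ℕ)) : Prop :=
  isAltFrom Quant.all i (P.map Prod.fst)

/-- The axiom set `H(Φ, Π_k)`: the clauses `C` on variables of `Φ` such that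
some `Π_k`-relaxation of `Φ[assign(C)]` is false. -/
def Hset (Φ : QBC) (k : ℕ) : Set PA :=
  {C | (∀ v, C v ≠ none → v ∈ Φ.vars) ∧
    ∃ Φ' : QBC, IsRelaxation (Φ.inst C) Φ' ∧ isPiPrefix k Φ'.pfx ∧ Φ'.IsFalse}

/-- `g` is a semicompletion of `f` (relative to prefix `P`). -/
def SemiComp (P : List (Quant × ℕ)) (f g : PA) : Prop :=
  ExtendsPA g f ∧
  ∀ y ∈ univVars P, f y = none → domPrec P f y → (g y = none ∧ domPrec P g y)

/-- A set of partial assignments of `Φ` is semicompletion-closed. -/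
def SemiCompClosed (Φ : QBC) (H : Set PA) : Prop :=
  ∀ f ∈ H, ∀ g : PA, (∀ v, g v ≠ none → v ∈ Φ.vars) → SemiComp Φ.pfx f g → g ∈ H

/-- Delayer condition (semicompletion-of-empty). -/
def CondEmpty (Φ : QBC) (F : Set PA) (s : PA → ℕ) : Prop :=
  ∃ g ∈ F, SemiComp Φ.pfx emptyPA g ∧ s g = 0

/-- Delayer condition (monotonicity). -/
def CondMono (Φ : QBC) (F : Set PA) (s : PA → ℕ) : Prop :=
  ∀ g ∈ F, ∀ f' : PA, ExtendsPA g f' → ∃ f ∈ F, SemiComp Φ.pfx f' f ∧ s f ≤ s g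

/-- Delayer condition (∀-branching). -/
def CondForallB (Φ : QBC) (F : Set PA) (s : PA → ℕ) : Prop :=
  ∀ f ∈ F, ∀ y ∈ univVars Φ.pfx, f y = none → domPrec Φ.pfx f y →
    ∀ b : Bool, ∃ g ∈ F, SemiComp Φ.pfx (Function.update f y (some b)) g ∧ s g = s f

/-- Delayer condition (double-branching). -/
def CondDoubleB (Φ : QBC) (F : Set PA) (s : PA → ℕ) : Prop :=
  ∀ f ∈ F, ∀ v ∈ Φ.vars, f v = none →
    ∃ b : Bool, ∃ g ∈ F, SemiComp Φ.pfx (Function.update f v (some b)) g ∧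
      s g ≤ s f + 1 ∧
      (s g = s f + 1 →
        ∃ g' ∈ F, SemiComp Φ.pfx (Function.update f v (some (!b))) g' ∧ s g' ≤ s f + 1)

/-- A `p`-point delayer strategy for `Φ` with respect to axiom set `H`. -/
def IsDelayer (Φ : QBC) (H : Set PA) (p : ℕ) (F : Set PA) (s : PA → ℕ) : Prop :=
  (∀ f ∈ F, ∀ v, f v ≠ none → v ∈ Φ.vars) ∧
  CondEmpty Φ F s ∧ (∀ f ∈ F, f ∈ H → p ≤ s f) ∧
  CondMono Φ F s ∧ CondForallB Φ F s ∧ CondDoubleB Φ F s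

/-! The separation formulas `Φₙ` of Section 6. -/

/-- The variable `x_{i,j,k}`. -/
def xV (i : ℕ) (j k : Bool) : ℕ := 9 * i + 2 * cond j 1 0 + cond k 1 0

/-- The variable `x'_{i,j,k}`. -/
def xV' (i : ℕ) (j k : Bool) : ℕ := 9 * i + 4 + 2 * cond j 1 0 + cond k 1 0

/-- The variable `yᵢ`. -/
def yV (i : ℕ) : ℕ := 9 * i + 8

/-- A block of four quantified variables. -/
def blockOf (q : Quant) (f : Bool → Bool → ℕ) : List (Quant × ℕ) :=
  [(q, f false false), (q, f false true), (q, f true false), (q, f true true)]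

/-- The prefix `∃X₀ ∃X'₁∀y₁∃X₁ ⋯ ∃X'ₙ∀yₙ∃Xₙ`. -/
def sepPrefix (n : ℕ) : List (Quant × ℕ) :=
  blockOf Quant.ex (xV 0) ++
    (List.range n).flatMap fun i =>
      blockOf Quant.ex (xV' (i + 1)) ++ [(Quant.all, yV (i + 1))] ++
        blockOf Quant.ex (xV (i + 1))

/-- The clause `¬x_{0,j,k}` (as its falsifying assignment). -/
def clB1 (j k : Bool) : PA := fun v => if v = xV 0 j k then some true else none

/-- The clause `x_{n,j,0} ∨ x_{n,j,1}`. -/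
def clB2 (n : ℕ) (j : Bool) : PA :=
  fun v => if v = xV n j false ∨ v = xV n j true then some false else none

/-- The clause `¬x'_{i,0,k} ∨ ¬x'_{i,1,l} ∨ x_{i−1,j,0} ∨ x_{i−1,j,1}`. -/
def clH (i : ℕ) (j k l : Bool) : PA := fun v =>
  if v = xV' i false k ∨ v = xV' i true l then some true
  else if v = xV (i - 1) j false ∨ v = xV (i - 1) j true then some false
  else none

/-- For `j = false` the clause `¬x_{i,0,k} ∨ yᵢ ∨ x'_{i,0,k}`; for `j = true`
the clause `¬x_{i,1,k} ∨ ¬yᵢ ∨ x'_{i,1,k}`. -/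
def clT (i : ℕ) (j k : Bool) : PA := fun v =>
  if v = xV i j k then some true
  else if v = yV i then some j
  else if v = xV' i j k then some false
  else none

/-- The set `Tᵢ` of clauses. -/
def Tset (i : ℕ) : Set PA := {C | ∃ j k : Bool, C = clT i j k}

/-- The set of clauses of the matrix `φₙ`. -/
def sepClauses (n : ℕ) : Set PA :=
  {C | (∃ j k : Bool, C = clB1 j k) ∨ (∃ j : Bool, C = clB2 n j) ∨
    (∃ i, 1 ≤ i ∧ i ≤ n ∧ ∃ j k l : Bool, C = clH i j k l) ∨
    (∃ i, 1 ≤ i ∧ i ≤ n ∧ ∃ j k : Bool, C = clT i j k)}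

/-- The separation formula `Φₙ`. -/
def sepQBC (n : ℕ) : QBC :=
  ⟨sepPrefix n, fun g => ∀ C ∈ sepClauses n, ¬ TotalExtends g C⟩

/-- The level-`i` variables `X'ᵢ ∪ {yᵢ} ∪ Xᵢ`. -/
def levelVars (i : ℕ) : List ℕ :=
  [xV' i false false, xV' i false true, xV' i true false, xV' i true true, yV i,
   xV i false false, xV i false true, xV i true false, xV i true true]

/-- `r` is defined exactly on the level-`i` variables. -/
def OnLevel (i : ℕ) (r : PA) : Prop := ∀ v, r v ≠ none ↔ v ∈ levelVars i

/-- A normal realization of level `i`. -/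
def NormalReal (i : ℕ) (r : PA) : Prop :=
  OnLevel i r ∧ ∃ b : Bool, r (yV i) = some b ∧
    r (xV i b false) = some false ∧ r (xV' i b false) = some false ∧
    r (xV i b true) = some false ∧ r (xV' i b true) = some false ∧
    ∃ c : Bool, r (xV i (!b) false) = some c ∧ r (xV' i (!b) false) = some c ∧
      r (xV i (!b) true) = some (!c) ∧ r (xV' i (!b) true) = some (!c)

/-- A funny realization of level `i`. -/
def FunnyReal (i : ℕ) (r : PA) : Prop :=
  OnLevel i r ∧ ∃ b : Bool, r (yV i) = some b ∧
    (∃ c : Bool, r (xV i b false) = some c ∧ r (xV' i b false) = some c ∧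
      r (xV i b true) = some (!c) ∧ r (xV' i b true) = some (!c)) ∧
    r (xV' i (!b) false) = some false ∧ r (xV' i (!b) true) = some false ∧
    ∃ d : Bool, r (xV i (!b) false) = some d ∧ r (xV i (!b) true) = some (!d)

/-- Restriction of a partial assignment to the level-`i` variables. -/
def restrictLevel (i : ℕ) (f : PA) : PA :=
  fun v => if v ∈ levelVars i then f v else none

-- The maximum level `ℓ` containing an existentially quantified variable of
-- `dom f` (and `0` if there is none).
open Classical in
noncomputable def maxLevel (n : ℕ) (f : PA) : ℕ :=
  ((Finset.Icc 1 n).filter fun i => ∃ v ∈ levelVars i, v ≠ yV i ∧ f v ≠ none).sup id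

/-- `f` is half-defined on level `ℓ`. -/
def HalfDefined (ℓ : ℕ) (f : PA) : Prop :=
  (∀ j k : Bool, f (xV ℓ j k) = none) ∧
  (∃ j k : Bool, f (xV' ℓ j k) = some true ∧
    ∀ j' k' : Bool, (j', k') ≠ (j, k) → f (xV' ℓ j' k') = some false)

/-- A normal assignment of `Φₙ`. -/
def NormalAssign (n : ℕ) (f : PA) : Prop :=
  (∀ v, f v ≠ none → v ∈ (sepPrefix n).map Prod.snd) ∧
  (∀ j k : Bool, f (xV 0 j k) = some false) ∧
  (∀ i, 1 ≤ i → i + 1 ≤ maxLevel n f → NormalReal i (restrictLevel i f)) ∧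
  (1 ≤ maxLevel n f →
    (NormalReal (maxLevel n f) (restrictLevel (maxLevel n f) f) ∨
      HalfDefined (maxLevel n f) f))

/-- A funny assignment of `Φₙ`, with witness `m` (so that `sₙ(f) = m`). -/
def FunnyAssign (n : ℕ) (f : PA) (m : ℕ) : Prop :=
  (∀ v, f v ≠ none → v ∈ (sepPrefix n).map Prod.snd) ∧
  1 ≤ m ∧ m ≤ maxLevel n f ∧
  (∀ j k : Bool, f (xV 0 j k) = some false) ∧
  (∀ i, 1 ≤ i → i < m → NormalReal i (restrictLevel i f)) ∧
  FunnyReal m (restrictLevel m f) ∧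
  (∀ i, m < i → i ≤ maxLevel n f → ∀ j : Bool,
    ((f (xV i j false) ≠ none ∨ f (xV i j true) ≠ none ∨
      f (xV' i j false) ≠ none ∨ f (xV' i j true) ≠ none) →
      ∃ c : Bool, f (xV i j false) = some c ∧ f (xV' i j false) = some c ∧
        f (xV i j true) = some (!c) ∧ f (xV' i j true) = some (!c)))

/-- The set `Fₙ` of normal and funny assignments. -/
def Fset (n : ℕ) : Set PA := {f | NormalAssign n f ∨ ∃ m, FunnyAssign n f m}

-- The score function `sₙ`.
open Classical in
noncomputable def score (n : ℕ) (f : PA) : ℕ :=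
  if h : ∃ m, FunnyAssign n f m then h.choose else maxLevel n f

/-! The mod-3 formulas `Ψₙ` of Section 7 (variables `xᵢ = 2i`, `yᵢ = 2i+1`). -/

/-- The prefix `∃x₁∀y₁⋯∃xₙ∀yₙ`. -/
def modPrefix (n : ℕ) : List (Quant × ℕ) :=
  (List.range n).flatMap fun i =>
    [(Quant.ex, 2 * (i + 1)), (Quant.all, 2 * (i + 1) + 1)]

/-- Numeric value of a Boolean. -/
def boolVal (b : Bool) : ℕ := cond b 1 0

/-- The matrix `φ_{n,j}`: true iff `j + Σᵢ (xᵢ + yᵢ) ≢ n (mod 3)`. -/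
def modMatrix (n j : ℕ) (g : ℕ → Bool) : Prop :=
  ¬ ((j + ∑ i ∈ Finset.Icc 1 n, (boolVal (g (2 * i)) + boolVal (g (2 * i + 1)))) % 3
      = n % 3)

/-- The mod-3 formula `Ψₙ`. -/
def modQBC (n : ℕ) : QBC := ⟨modPrefix n, modMatrix n 0⟩

theorem fap_mem_exist (n v : ℕ) : v ∈ existVars (sepPrefix n) ↔
    (∃ j k, v = xV 0 j k) ∨ ∃ i, 1 ≤ i ∧ i ≤ n ∧ ∃ j k, (v = xV i j k ∨ v = xV' i j k) := by
  simp only [existVars, sepPrefix, List.mem_map, List.mem_filter, List.mem_append,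
    List.mem_flatMap, List.mem_range, blockOf, List.mem_cons, List.not_mem_nil, or_false,
    decide_eq_true_eq]
  constructor
  · rintro ⟨⟨q, w⟩, ⟨h | ⟨i, hi, h⟩, hq⟩, rfl⟩
    · left
      simp only [Prod.mk.injEq] at h
      rcases h with h | h | h | h <;> exact ⟨_, _, h.2⟩
    · right
      refine ⟨i + 1, by omega, by omega, ?_⟩
      simp only [Prod.mk.injEq] at h hq
      rcases h with ((h | h | h | h) | h) | h | h | h | h
      · exact ⟨_, _, Or.inr h.2⟩
      · exact ⟨_, _, Or.inr h.2⟩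
      · exact ⟨_, _, Or.inr h.2⟩
      · exact ⟨_, _, Or.inr h.2⟩
      · rw [h.1] at hq; cases hq
      · exact ⟨_, _, Or.inl h.2⟩
      · exact ⟨_, _, Or.inl h.2⟩
      · exact ⟨_, _, Or.inl h.2⟩
      · exact ⟨_, _, Or.inl h.2⟩
  · rintro (⟨j, k, rfl⟩ | ⟨i, h1, h2, j, k, h⟩)
    · refine ⟨(Quant.ex, xV 0 j k), ⟨Or.inl ?_, rfl⟩, rfl⟩
      cases j <;> cases k <;> simp [xV]
    · obtain ⟨i, rfl⟩ : ∃ iq, i = iq + 1 := ⟨i - 1, by omega⟩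
      refine ⟨(Quant.ex, _), ⟨Or.inr ⟨i, by omega, ?_⟩, rfl⟩, rfl⟩
      rcases h with rfl | rfl <;> cases j <;> cases k <;> simp

theorem fap_exist_sub (n v : ℕ) (h : v ∈ existVars (sepPrefix n)) :
    v ∈ (sepPrefix n).map Prod.snd := by
  simp only [existVars, List.mem_map, List.mem_filter] at h ⊢
  obtain ⟨p, hp, e⟩ := h
  exact ⟨p, hp.1, e⟩

theorem fap_maxLevel_le (n : ℕ) (f : PA) : maxLevel n f ≤ n := by
  unfold maxLevel
  apply Finset.sup_le
  intro i hi
  simp only [Finset.mem_filter, Finset.mem_Icc] at hi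
  exact hi.1.2

theorem fap_le_maxLevel (n : ℕ) (f : PA) (i v : ℕ) (h1 : 1 ≤ i) (h2 : i ≤ n)
    (hv : v ∈ levelVars i) (hy : v ≠ yV i) (hf : f v ≠ none) : i ≤ maxLevel n f := by
  unfold maxLevel
  exact Finset.le_sup (f := id) (by
    simp only [Finset.mem_filter, Finset.mem_Icc]
    exact ⟨⟨h1, h2⟩, v, hv, hy, hf⟩)

theorem fap_x_level (i : ℕ) (j k : Bool) : xV i j k ∈ levelVars i ∧ xV i j k ≠ yV i := by
  cases j <;> cases k <;> simp [levelVars, xV, yV]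

theorem fap_xp_level (i : ℕ) (j k : Bool) : xV' i j k ∈ levelVars i ∧ xV' i j k ≠ yV i := by
  cases j <;> cases k <;> simp [levelVars, xV', yV]

/-- The completion of a partial assignment on the existential variables. -/
def fapExt (n : ℕ) (f : PA) : PA := fun v =>
  if f v = none ∧ v ∈ existVars (sepPrefix n) then some (decide (v % 9 % 2 = 1)) else f v

theorem fapExt_of_some (n : ℕ) (f : PA) (v : ℕ) (h : f v ≠ none) : fapExt n f v = f v := by
  simp [fapExt, h]

theorem fap_restrict_ext (n : ℕ) (f : PA) (i : ℕ) (h : OnLevel i (restrictLevel i f)) :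
    restrictLevel i (fapExt n f) = restrictLevel i f := by
  funext v
  unfold restrictLevel
  split_ifs with hv
  · apply fapExt_of_some
    have := (h v).2 hv
    simpa [restrictLevel, hv] using this
  · rfl

theorem fap_pair (n : ℕ) (f : PA) (m : ℕ) (hf : FunnyAssign n f m) (i : ℕ) (hi : m < i)
    (j : Bool) :
    ((f (xV i j false) = none ∧ f (xV i j true) = none ∧
      f (xV' i j false) = none ∧ f (xV' i j true) = none) ∨
      ∃ c : Bool, f (xV i j false) = some c ∧ f (xV' i j false) = some c ∧
        f (xV i j true) = some (!c) ∧ f (xV' i j true) = some (!c)) ∨ n < i := by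
  obtain ⟨-, h1, h2, -, -, -, h3⟩ := hf
  by_cases hin : n < i
  · exact Or.inr hin
  left
  by_cases hl : i ≤ maxLevel n f
  · have := h3 i hi hl j
    tauto
  · left
    have key : ∀ v ∈ levelVars i, v ≠ yV i → f v = none := by
      intro v hv hy
      by_contra hc
      exact hl (fap_le_maxLevel n f i v (by omega) (by omega) hv hy hc)
    exact ⟨key _ (fap_x_level _ _ _).1 (fap_x_level _ _ _).2,
      key _ (fap_x_level _ _ _).1 (fap_x_level _ _ _).2,
      key _ (fap_xp_level _ _ _).1 (fap_xp_level _ _ _).2,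
      key _ (fap_xp_level _ _ _).1 (fap_xp_level _ _ _).2⟩

theorem fap_x_par (i : ℕ) (j k : Bool) : decide (xV i j k % 9 % 2 = 1) = k := by
  cases j <;> cases k <;> simp [xV] <;> omega

theorem fap_xp_par (i : ℕ) (j k : Bool) : decide (xV' i j k % 9 % 2 = 1) = k := by
  cases j <;> cases k <;> simp [xV'] <;> omega

theorem fap_extend (n : ℕ) (hn : 1 ≤ n) (f : PA) (m : ℕ) (hf : FunnyAssign n f m) :
    ExtendsPA (fapExt n f) f ∧ FunnyAssign n (fapExt n f) m ∧
        ∀ v ∈ existVars (sepPrefix n), fapExt n f v ≠ none := by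
  have hdef : ∀ v ∈ existVars (sepPrefix n), fapExt n f v ≠ none := by
    intro v hv
    unfold fapExt
    split_ifs with h
    · simp
    · tauto
  have hpair := fap_pair n f m hf
  obtain ⟨h0, h1, h2, h3, h4, h5, h6⟩ := hf
  have hmn := fap_maxLevel_le n f
  refine ⟨?_, ⟨?_, h1, ?_, ?_, ?_, ?_, ?_⟩, hdef⟩
  · intro v b h
    rw [fapExt_of_some n f v (by simp [h]), h]
  · intro v hv
    by_cases h : f v = none
    · by_cases he : v ∈ existVars (sepPrefix n)
      · exact fap_exist_sub n v he
      · simp [fapExt, he, h] at hv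
    · exact h0 v h
  · apply fap_le_maxLevel n _ m (xV m false false) h1 (by omega) (fap_x_level _ _ _).1
      (fap_x_level _ _ _).2 
    apply hdef
    rw [fap_mem_exist]
    exact Or.inr ⟨m, h1, by omega, _, _, Or.inl rfl⟩
  · intro j k
    rw [fapExt_of_some] <;> simp [h3]
  · intro i hi1 hi2
    rw [fap_restrict_ext n f i (h4 i hi1 hi2).1]
    exact h4 i hi1 hi2
  · rw [fap_restrict_ext n f m h5.1]
    exact h5
  · intro i hi hi2 j _
    have hin : i ≤ n := le_trans hi2 (fap_maxLevel_le _ _)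
    have ex : ∀ k, xV i j k ∈ existVars (sepPrefix n) := fun k => by
      rw [fap_mem_exist]
      exact Or.inr ⟨i, by omega, by omega, _, _, Or.inl rfl⟩
    have exq : ∀ k, xV' i j k ∈ existVars (sepPrefix n) := fun k => by
      rw [fap_mem_exist]
      exact Or.inr ⟨i, by omega, by omega, _, _, Or.inr rfl⟩
    rcases hpair i hi j with (⟨a, b, c, d⟩ | ⟨c, a1, a2, a3, a4⟩) | h
    · refine ⟨false, ?_, ?_, ?_, ?_⟩
      · simp only [fapExt, a, ex, and_self, if_true, fap_x_par]
      · simp only [fapExt, c, exq, and_self, if_true, fap_xp_par]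
      · simp only [fapExt, b, ex, and_self, if_true, fap_x_par, Bool.not_false]
      · simp only [fapExt, d, exq, and_self, if_true, fap_xp_par, Bool.not_false]
    · refine ⟨c, ?_, ?_, ?_, ?_⟩ <;> rw [fapExt_of_some] <;> simp [*]
    · omega

theorem fap_restrict_some (i : ℕ) (f : PA) (v : ℕ) (b : Bool)
    (h : restrictLevel i f v = some b) : f v = some b := by
  unfold restrictLevel at h
  split_ifs at h
  exact h

theorem fap_sat (n : ℕ) (hn : 1 ≤ n) (f : PA) (g : ℕ → Bool) (m : ℕ) (hf : FunnyAssign n f m)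
    (hex : ∀ v ∈ existVars (sepPrefix n), f v ≠ none) (hg : TotalExtends g f) :
    ∀ C ∈ sepClauses n, ¬ TotalExtends g C := by
  have hpair := fap_pair n f m hf
  obtain ⟨h0, h1, h2, h3, h4, h5, h6⟩ := hf
  have hmn := fap_maxLevel_le n f
  -- normal levels
  have N : ∀ i, 1 ≤ i → i < m → ∃ b, (∀ k, g (xV' i b k) = false) ∧
      ∀ j k, g (xV i j k) = g (xV' i j k) := by
    intro i hi him
    obtain ⟨-, b, hb, e1, e2, e3, e4, c, e5, e6, e7, e8⟩ := h4 i hi him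
    replace e1 := hg _ _ (fap_restrict_some _ _ _ _ e1)
    replace e2 := hg _ _ (fap_restrict_some _ _ _ _ e2)
    replace e3 := hg _ _ (fap_restrict_some _ _ _ _ e3)
    replace e4 := hg _ _ (fap_restrict_some _ _ _ _ e4)
    replace e5 := hg _ _ (fap_restrict_some _ _ _ _ e5)
    replace e6 := hg _ _ (fap_restrict_some _ _ _ _ e6)
    replace e7 := hg _ _ (fap_restrict_some _ _ _ _ e7)
    replace e8 := hg _ _ (fap_restrict_some _ _ _ _ e8)
    refine ⟨b, ?_, ?_⟩
    · intro k; cases k <;> assumption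
    · intro j k
      cases b <;> cases j <;> cases k <;> simp_all
  -- the funny level
  have F : ∃ b, g (yV m) = b ∧ (∀ k, g (xV m b k) = g (xV' m b k)) ∧
      (∀ k, g (xV' m (!b) k) = false) ∧ ∀ j, g (xV m j true) = ! g (xV m j false) := by
    obtain ⟨-, b, hb, ⟨c, e1, e2, e3, e4⟩, e5, e6, d, e7, e8⟩ := h5
    replace hb := hg _ _ (fap_restrict_some _ _ _ _ hb)
    replace e1 := hg _ _ (fap_restrict_some _ _ _ _ e1)
    replace e2 := hg _ _ (fap_restrict_some _ _ _ _ e2)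
    replace e3 := hg _ _ (fap_restrict_some _ _ _ _ e3)
    replace e4 := hg _ _ (fap_restrict_some _ _ _ _ e4)
    replace e5 := hg _ _ (fap_restrict_some _ _ _ _ e5)
    replace e6 := hg _ _ (fap_restrict_some _ _ _ _ e6)
    replace e7 := hg _ _ (fap_restrict_some _ _ _ _ e7)
    replace e8 := hg _ _ (fap_restrict_some _ _ _ _ e8)
    refine ⟨b, hb, ?_, ?_, ?_⟩
    · intro k; cases k <;> simp_all
    · intro k; cases k <;> assumption
    · intro j; cases b <;> cases j <;> simp_all
  -- levels above
  have A : ∀ i, m < i → i ≤ n → ∀ j, (∀ k, g (xV i j k) = g (xV' i j k)) ∧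
      g (xV i j true) = ! g (xV i j false) := by
    intro i hi hin j
    rcases hpair i hi j with (⟨a, -⟩ | ⟨c, a1, a2, a3, a4⟩) | h
    · exfalso
      refine hex _ ?_ a
      rw [fap_mem_exist]
      exact Or.inr ⟨i, by omega, by omega, _, _, Or.inl rfl⟩
    · replace a1 := hg _ _ a1
      replace a2 := hg _ _ a2
      replace a3 := hg _ _ a3
      replace a4 := hg _ _ a4
      refine ⟨?_, ?_⟩
      · intro k; cases k <;> simp_all
      · simp_all
    · omega
  obtain ⟨b, Fy, Fx, Fz, Fp⟩ := F
  have P : ∀ i, m ≤ i → i ≤ n → ∀ j, g (xV i j true) = ! g (xV i j false) := by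
    intro i hi hin j
    rcases hi.eq_or_lt with rfl | h
    · exact Fp j
    · exact (A i h hin j).2
  rintro C (⟨j, k, rfl⟩ | ⟨j, rfl⟩ | ⟨i, hi1, hin, j, k, l, rfl⟩ | ⟨i, hi1, hin, j, k, rfl⟩) hC
  · have a := hC (xV 0 j k) true (by simp [clB1])
    rw [hg _ _ (h3 j k)] at a
    cases a
  · have a := hC (xV n j false) false (by simp [clB2])
    have aq := hC (xV n j true) false (by simp [clB2])
    have := P n (by omega) le_rfl j
    simp [a, aq] at this
  · have a := hC (xV' i false k) true (by simp [clH])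
    have aq := hC (xV' i true l) true (by simp [clH])
    rcases lt_trichotomy i m with h | rfl | h
    · obtain ⟨bq, hb, -⟩ := N i hi1 h
      cases bq
      · rw [hb k] at a; cases a
      · rw [hb l] at aq; cases aq
    · cases b
      · have := Fz l
        simp [aq] at this
      · have := Fz k
        simp [a] at this
    · have ne : ∀ kp jq kq, xV (i - 1) j kp ≠ xV' i jq kq := by
        intro kp jq kq
        unfold xV xV'
        cases j <;> cases kp <;> simp <;> omega
      have c := hC (xV (i - 1) j false) false (by simp [clH, ne])
      have cq := hC (xV (i - 1) j true) false (by simp [clH, ne])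
      have := P (i - 1) (by omega) (by omega) j
      simp [c, cq] at this
  · have n1 : yV i ≠ xV i j k := fun h => (fap_x_level i j k).2 h.symm
    have n2 : xV' i j k ≠ yV i := (fap_xp_level i j k).2
    have n3 : xV' i j k ≠ xV i j k := by
      unfold xV xV'
      cases j <;> cases k <;> simp
    have a := hC (xV i j k) true (by simp [clT])
    have aq := hC (xV' i j k) false (by simp [clT, n2, n3])
    have y := hC (yV i) j (by simp [clT, n1])
    rcases lt_trichotomy i m with h | rfl | h
    · obtain ⟨bq, -, hb⟩ := N i hi1 h
      have := hb j k
      simp [a, aq] at this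
    · have hj : b = j := by rw [← Fy, y]
      subst hj
      have := Fx k
      simp [a, aq] at this
    · have := (A i h hin j).1 k
      simp [a, aq] at this

/-- Proposition 6.3: every funny assignment `f` of `Φₙ` with
`sₙ(f) = m` extends to a funny assignment `f'` with `sₙ(f') = m` defined on
all existentially quantified variables; moreover, any total assignment
extending a funny assignment defined on all existentially quantified
variables satisfies all clauses of `φₙ`. -/
theorem funny_assignment_properties (n : ℕ) (hn : 1 ≤ n) :
    (∀ (f : PA) (m : ℕ), FunnyAssign n f m →
      ∃ f' : PA, ExtendsPA f' f ∧ FunnyAssign n f' m ∧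
        ∀ v ∈ existVars (sepPrefix n), f' v ≠ none) ∧
    (∀ (f : PA) (g : ℕ → Bool), (∃ m, FunnyAssign n f m) →
      (∀ v ∈ existVars (sepPrefix n), f v ≠ none) → TotalExtends g f →
      ∀ C ∈ sepClauses n, ¬ TotalExtends g C) := by
  exact ⟨fun f m hf => ⟨fapExt n f, fap_extend n hn f m hf⟩,
    fun f g ⟨m, hf⟩ hex hg => fap_sat n hn f g m hf hex hg⟩
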